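/- arXiv:1902.07797 — 2 statements merged into one kernel-verified Lean document; each statement's English description precedes it below -/
import Mathlib

section
/- Let U be any uniform covering of SL(2,ℝ) with associated metric d_U. Then for all k, l, r ≥ 1 there is no quasi-isometric embedding from (SL(2,ℝ), d_U) to (ℝᵏ, d_{U(ℝᵏ)}), no quasi-isometric embedding from (SL(2,ℝ), d_U) to (ℝ^{2l+1}, d_{P_l}), and no quasi-isometric embedding from (SL(2,ℝ), d_U) to (ℝʳ, d_{B(ℝʳ)}). -/
open Set Pointwise MeasureTheory
open scoped Classical

/-- A `Q`-chain of length `k` from `x` to `y`: a sequence `Q_{i₁}, …, Q_{i_k}` of members of the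
covering with `x ∈ Q_{i₁}`, `y ∈ Q_{i_k}` and consecutive members intersecting. -/
def ChainExists {X I : Type*} (Q : I → Set X) (k : ℕ) (x y : X) : Prop :=
  ∃ (hk : 0 < k) (c : Fin k → I),
    x ∈ Q (c ⟨0, hk⟩) ∧ y ∈ Q (c ⟨k - 1, Nat.sub_lt hk Nat.one_pos⟩) ∧
      ∀ (l : ℕ) (h : l + 1 < k),
        (Q (c ⟨l, by omega⟩) ∩ Q (c ⟨l + 1, h⟩)).Nonempty

/-- An admissible covering: a family of nonempty sets covering `X` such that the number of
neighbours of each member is uniformly bounded. -/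
def IsAdmissibleCovering {X I : Type*} (Q : I → Set X) : Prop :=
  (∀ i, (Q i).Nonempty) ∧ (⋃ i, Q i) = Set.univ ∧
    ∃ N : ℕ, ∀ i, {j | (Q i ∩ Q j).Nonempty}.Finite ∧ {j | (Q i ∩ Q j).Nonempty}.ncard ≤ N

/-- A concatenation: an admissible covering in which any two points are joined by a chain. -/
def IsConcatenation {X I : Type*} (Q : I → Set X) : Prop :=
  IsAdmissibleCovering Q ∧ ∀ x y : X, ∃ k : ℕ, ChainExists Q k x y

/-- The associated metric `d_Q` of a covered space `(X, Q)`. -/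
noncomputable def coveredDist {X I : Type*} (Q : I → Set X) (x y : X) : ℝ :=
  if x = y then 0 else ((sInf {k : ℕ | ChainExists Q k x y} : ℕ) : ℝ)

/-- Quasi-isometric embedding between (abstract) metric spaces. -/
def IsQIEmbedding {X Z : Type*} (dX : X → X → ℝ) (dZ : Z → Z → ℝ) (f : X → Z) : Prop :=
  ∃ L C : ℝ, 0 < L ∧ 0 < C ∧ ∀ x y : X,
    (1 / L) * dX x y - C ≤ dZ (f x) (f y) ∧ dZ (f x) (f y) ≤ L * dX x y + C

/-- Quasi-isometry: a quasi-isometric embedding whose image is a net. -/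
def IsQuasiIsometry {X Z : Type*} (dX : X → X → ℝ) (dZ : Z → Z → ℝ) (f : X → Z) : Prop :=
  IsQIEmbedding dX dZ f ∧ ∃ M : ℝ, 0 < M ∧ ∀ z : Z, ∃ x : X, dZ z (f x) ≤ M

/-- The iterated neighbourhood `P_j^{k*}` of a member of a covering. -/
def starSet {X J : Type*} (P : J → Set X) (j : J) : ℕ → Set X
  | 0 => P j
  | k + 1 => ⋃ l ∈ {l | (P l ∩ starSet P j k).Nonempty}, P l

/-- `Q` is almost subordinate to `P`. -/
def AlmostSubordinate {X I J : Type*} (Q : I → Set X) (P : J → Set X) : Prop :=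
  ∃ k : ℕ, ∀ i : I, ∃ j : J, Q i ⊆ starSet P j k

/-- Two coverings of the same set are equivalent if each is almost subordinate to the other. -/
def EquivalentCoverings {X I J : Type*} (Q : I → Set X) (P : J → Set X) : Prop :=
  AlmostSubordinate Q P ∧ AlmostSubordinate P Q

/-- The word metric associated to a generating set `S` of a group. -/
noncomputable def wordDist {G : Type*} [Group G] (S : Set G) (g h : G) : ℝ :=
  ((sInf {n : ℕ | ∃ w : Fin n → G, (∀ i, w i ∈ S) ∧ g⁻¹ * h = (List.ofFn w).prod} : ℕ) : ℝ)

/-- The uniform covering of `ℝⁿ` by the integer translates of the unit cube. -/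
def uniformCovering (n : ℕ) : (Fin n → ℤ) → Set (Fin n → ℝ) :=
  fun v => {x | ∀ i, (v i : ℝ) ≤ x i ∧ x i ≤ (v i : ℝ) + 1}

/-- The dyadic covering of `ℝⁿ` (with the Euclidean norm). -/
def dyadicCovering (n : ℕ) : ℕ → Set (EuclideanSpace ℝ (Fin n)) :=
  fun m => if m = 0 then {x | ‖x‖ ≤ 2}
           else {x | (2 : ℝ) ^ (m - 1) ≤ ‖x‖ ∧ ‖x‖ ≤ (2 : ℝ) ^ (m + 1)}

/-- A uniform covering of a topological group: an admissible covering by left translates of a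
nonempty, open, symmetric, precompact reference set. -/
def IsUniformCovering {G : Type*} [Group G] [TopologicalSpace G] {I : Type*}
    (U : I → Set G) : Prop :=
  IsAdmissibleCovering U ∧
    ∃ (Q₀ : Set G) (g : I → G), Q₀.Nonempty ∧ IsOpen Q₀ ∧ Q₀⁻¹ = Q₀ ∧
      IsCompact (closure Q₀) ∧ ∀ i, U i = g i • Q₀

/-- The underlying space `ℝ^{2n+1} = ℝⁿ × ℝⁿ × ℝ` of the Heisenberg group. -/
abbrev HeisReal (n : ℕ) : Type := (Fin n → ℝ) × (Fin n → ℝ) × ℝ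

/-- The integer points `ℤ^{2n+1}`, underlying the discrete Heisenberg group. -/
abbrev HeisInt (n : ℕ) : Type := (Fin n → ℤ) × (Fin n → ℤ) × ℤ

/-- The Heisenberg product `(a,b,c) * (a',b',c') = (a+a', b+b', c+c'+a·b')` on `ℝ^{2n+1}`. -/
def heisMul {n : ℕ} (p q : HeisReal n) : HeisReal n :=
  (p.1 + q.1, p.2.1 + q.2.1, p.2.2 + q.2.2 + ∑ i, p.1 i * q.2.1 i)

/-- The Heisenberg product on `ℤ^{2n+1}`, making it the discrete Heisenberg group
`ℍ_{2n+1}(ℤ)`. -/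
def heisMulZ {n : ℕ} (p q : HeisInt n) : HeisInt n :=
  (p.1 + q.1, p.2.1 + q.2.1, p.2.2 + q.2.2 + ∑ i, p.1 i * q.2.1 i)

/-- The inclusion `ℤ^{2n+1} ⊆ ℝ^{2n+1}`. -/
def heisEmbed {n : ℕ} (γ : HeisInt n) : HeisReal n :=
  (fun i => (γ.1 i : ℝ), fun i => (γ.2.1 i : ℝ), (γ.2.2 : ℝ))

/-- The unit cube `[0,1]^{2n+1}` in `ℝ^{2n+1}`. -/
def heisCube (n : ℕ) : Set (HeisReal n) :=
  {p | (∀ i, p.1 i ∈ Set.Icc (0 : ℝ) 1) ∧ (∀ i, p.2.1 i ∈ Set.Icc (0 : ℝ) 1) ∧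
    p.2.2 ∈ Set.Icc (0 : ℝ) 1}

/-- The Heisenberg covering `P_n = (γ * [0,1]^{2n+1})_{γ ∈ ℤ^{2n+1}}` of `ℝ^{2n+1}`. -/
def heisCover (n : ℕ) : HeisInt n → Set (HeisReal n) :=
  fun γ => (fun x => heisMul (heisEmbed γ) x) '' heisCube n

/-- The uniform covering of `ℝ^{2n+1}` by additive integer translates of the unit cube. -/
def uniformCoverH (n : ℕ) : HeisInt n → Set (HeisReal n) :=
  fun γ => (fun x => heisEmbed γ + x) '' heisCube n

/-- `SL(2,ℝ)`. -/
abbrev SL2R : Type := Matrix.SpecialLinearGroup (Fin 2) ℝ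

/-- The topology of `SL(2,ℝ)` as a subspace of the `2 × 2` real matrices. -/
instance : TopologicalSpace SL2R :=
  inferInstanceAs (TopologicalSpace { A : Matrix (Fin 2) (Fin 2) ℝ // A.det = 1 })

/-- `γ` is a quasi-isometric embedding, with parameters `L, C`, of the interval `[0,a]`
into `(X,d)`. -/
def IsQIEmbOn {X : Type*} (d : X → X → ℝ) (L C a : ℝ) (γ : ℝ → X) : Prop :=
  ∀ s ∈ Set.Icc (0 : ℝ) a, ∀ t ∈ Set.Icc (0 : ℝ) a,
    (1 / L) * |s - t| - C ≤ d (γ s) (γ t) ∧ d (γ s) (γ t) ≤ L * |s - t| + C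

/-- The side `γ : [0,a] → X` lies in the `δ`-neighbourhood of the union of the two other sides
`γ₂ : [0,b] → X` and `γ₃ : [0,c] → X`. -/
def SideSlim {X : Type*} (d : X → X → ℝ) (δ a : ℝ) (γ : ℝ → X) (b c : ℝ)
    (γ₂ γ₃ : ℝ → X) : Prop :=
  ∀ t ∈ Set.Icc (0 : ℝ) a, ∃ s : ℝ,
    (s ∈ Set.Icc (0 : ℝ) b ∧ d (γ t) (γ₂ s) ≤ δ) ∨ (s ∈ Set.Icc (0 : ℝ) c ∧ d (γ t) (γ₃ s) ≤ δ)

/-- A (quasi-geodesic) metric space is quasi-hyperbolic if there are `L, C, δ > 0` such that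
every quasi-geodesic triangle with parameters `L' ≥ L`, `C' ≥ C` is `δ`-slim. -/
def IsQuasiHyperbolic {X : Type*} (d : X → X → ℝ) : Prop :=
  ∃ L C δ : ℝ, 0 < L ∧ 0 < C ∧ 0 < δ ∧
    ∀ L' C' : ℝ, L ≤ L' → C ≤ C' →
      ∀ (a₁ a₂ a₃ : ℝ) (γ₁ γ₂ γ₃ : ℝ → X),
        0 ≤ a₁ → 0 ≤ a₂ → 0 ≤ a₃ →
        IsQIEmbOn d L' C' a₁ γ₁ → IsQIEmbOn d L' C' a₂ γ₂ → IsQIEmbOn d L' C' a₃ γ₃ →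
        γ₁ a₁ = γ₂ 0 → γ₂ a₂ = γ₃ 0 → γ₃ a₃ = γ₁ 0 →
        SideSlim d δ a₁ γ₁ a₂ a₃ γ₂ γ₃ ∧ SideSlim d δ a₂ γ₂ a₃ a₁ γ₃ γ₁ ∧
          SideSlim d δ a₃ γ₃ a₁ a₂ γ₁ γ₂

section Chains

variable {X I : Type*} {Q : I → Set X}

theorem chainExists_iff_nat {k : ℕ} {x y : X} :
    ChainExists Q k x y ↔ 0 < k ∧ ∃ c : ℕ → I, x ∈ Q (c 0) ∧ y ∈ Q (c (k - 1)) ∧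
      ∀ l, l + 1 < k → (Q (c l) ∩ Q (c (l + 1))).Nonempty := by
  constructor
  · rintro ⟨hk, c, hx, hy, h⟩
    refine ⟨hk, fun l => if hl : l < k then c ⟨l, hl⟩ else c ⟨0, hk⟩, ?_, ?_, ?_⟩
    · simpa [hk] using hx
    · have : k - 1 < k := by omega
      simpa [this] using hy
    · intro l hl
      have h1 : l < k := by omega
      simpa [h1, hl] using h l hl
  · rintro ⟨hk, c, hx, hy, h⟩
    exact ⟨hk, fun l => c l, hx, hy, fun l hl => h l hl⟩

theorem ChainExists.trans {k k' : ℕ} {x y z : X} (h : ChainExists Q k x y)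
    (h' : ChainExists Q k' y z) : ChainExists Q (k + k') x z := by
  rw [chainExists_iff_nat] at *
  obtain ⟨hk, c, hx, hy, hc⟩ := h
  obtain ⟨hk', c', hx', hy', hc'⟩ := h'
  refine ⟨by omega, fun l => if l < k then c l else c' (l - k), ?_, ?_, ?_⟩
  · simpa [hk] using hx
  · have h1 : ¬ (k + k' - 1 < k) := by omega
    have h2 : k + k' - 1 - k = k' - 1 := by omega
    simpa [h1, h2] using hy'
  · intro l hl
    rcases lt_trichotomy (l + 1) k with h1 | h1 | h1
    · have h2 : l < k := by omega
      simpa [h1, h2] using hc l h1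
    · have h2 : l < k := by omega
      have h3 : l = k - 1 := by omega
      have h4 : ¬ (k - 1 + 1 < k) := by omega
      have h5 : k - 1 + 1 - k = 0 := by omega
      subst h3
      refine ⟨y, ?_⟩
      simp [h2, h4, h5, hx', hy]
    · have h2 : ¬ l < k := by omega
      have h3 : ¬ l + 1 < k := by omega
      have h4 : l + 1 - k = (l - k) + 1 := by omega
      simpa [h2, h3, h4] using hc' (l - k) (by omega)

theorem chainExists_one {x y : X} (i : I) (hx : x ∈ Q i) (hy : y ∈ Q i) :
    ChainExists Q 1 x y :=
  ⟨Nat.one_pos, fun _ => i, hx, hy, fun l h => by omega⟩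

theorem ChainExists.exists_split {k : ℕ} {x y : X} (h : ChainExists Q (k + 2) x y) :
    ∃ z, ChainExists Q (k + 1) x z ∧ ∃ i, z ∈ Q i ∧ y ∈ Q i := by
  rw [chainExists_iff_nat] at h
  obtain ⟨-, c, hx, hy, hc⟩ := h
  obtain ⟨z, hz, hz'⟩ := hc k (by omega)
  refine ⟨z, chainExists_iff_nat.2 ⟨by omega, c, hx, hz, fun l hl => hc l (by omega)⟩,
    c (k + 1), hz', hy⟩

theorem coveredDist_le {k : ℕ} {x y : X} (h : ChainExists Q k x y) :
    coveredDist Q x y ≤ k := by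
  unfold coveredDist
  split_ifs
  · positivity
  · exact_mod_cast Nat.sInf_le h

theorem exists_chain_of_coveredDist_pos {x y : X} (h : 0 < coveredDist Q x y) :
    ∃ k : ℕ, (k : ℝ) = coveredDist Q x y ∧ ChainExists Q k x y := by
  unfold coveredDist at *
  split_ifs at * with hxy
  · simp at h
  · have h' : 0 < sInf {k : ℕ | ChainExists Q k x y} := by exact_mod_cast h
    exact ⟨_, rfl, Nat.sInf_mem (Nat.nonempty_of_pos_sInf h')⟩

theorem lt_coveredDist {R k : ℕ} {x y : X} (hxy : x ≠ y) (hk : ChainExists Q k x y)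
    (h : ∀ k ≤ R, ¬ ChainExists Q k x y) : (R : ℝ) < coveredDist Q x y := by
  unfold coveredDist
  rw [if_neg hxy, Nat.cast_lt]
  by_contra! h'
  exact h _ h' (Nat.sInf_mem (s := {k | ChainExists Q k x y}) ⟨k, hk⟩)

theorem exists_chain_of_isPreconnected [TopologicalSpace X] (hQ : ∀ i, IsOpen (Q i))
    (hcov : ⋃ i, Q i = Set.univ) {K : Set X} (hK : IsPreconnected K)
    (hfin : {i | (Q i ∩ K).Nonempty}.Finite) {x y : X} (hx : x ∈ K) (hy : y ∈ K) :
    ∃ k ≤ {i | (Q i ∩ K).Nonempty}.ncard, ChainExists Q k x y := by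
  set s := {i | (Q i ∩ K).Nonempty} with hs
  have : Fintype s := hfin.fintype
  let G : SimpleGraph s := SimpleGraph.fromRel fun i j => (Q i ∩ Q j).Nonempty
  have hG : ∀ i j : s, (Q i ∩ Q j).Nonempty → G.Reachable i j := by
    intro i j hij
    by_cases h : i = j
    · rw [h]
    · exact SimpleGraph.Adj.reachable ((SimpleGraph.fromRel_adj _ _ _).2 ⟨h, Or.inl hij⟩)
  have hmem : ∀ z ∈ K, ∃ i : s, z ∈ Q i := by
    intro z hz
    obtain ⟨i, hi⟩ := Set.mem_iUnion.1 (hcov ▸ Set.mem_univ z)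
    exact ⟨⟨i, z, hi, hz⟩, hi⟩
  obtain ⟨i, hi⟩ := hmem x hx
  obtain ⟨j, hj⟩ := hmem y hy
  have hij : G.Reachable i j := by
    by_contra hij
    obtain ⟨z, -, hz, hz'⟩ := hK (⋃ a ∈ {a : s | G.Reachable i a}, Q a)
      (⋃ a ∈ {a : s | ¬ G.Reachable i a}, Q a)
      (isOpen_biUnion fun a _ => hQ a) (isOpen_biUnion fun a _ => hQ a)
      (by
        intro z hz
        obtain ⟨a, ha⟩ := hmem z hz
        by_cases h : G.Reachable i a
        · exact Or.inl (Set.mem_biUnion (show a ∈ {a : s | G.Reachable i a} from h) ha)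
        · exact Or.inr (Set.mem_biUnion (show a ∈ {a : s | ¬ G.Reachable i a} from h) ha))
      ⟨x, hx, Set.mem_biUnion (show i ∈ {a : s | G.Reachable i a} from .rfl) hi⟩
      ⟨y, hy, Set.mem_biUnion (show j ∈ {a : s | ¬ G.Reachable i a} from hij) hj⟩
    simp only [Set.mem_iUnion] at hz hz'
    obtain ⟨a, ha, hza⟩ := hz
    obtain ⟨b, hb, hzb⟩ := hz'
    exact hb (SimpleGraph.Reachable.trans ha (hG a b ⟨z, hza, hzb⟩))
  obtain ⟨p, hp⟩ := hij.exists_isPath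
  refine ⟨p.length + 1, ?_, ?_⟩
  · have := hp.length_lt
    rw [← Nat.card_coe_set_eq, Nat.card_eq_fintype_card]
    exact this
  · rw [chainExists_iff_nat]
    refine ⟨by omega, fun l => p.getVert l, by simpa using hi, by simpa using hj, ?_⟩
    intro l hl
    have h := p.adj_getVert_succ (i := l) (by omega)
    rw [SimpleGraph.fromRel_adj] at h
    rcases h.2 with h | h
    · exact h
    · rwa [Set.inter_comm]

end Chains

section UniformCovering

variable {G : Type*} [Group G] [TopologicalSpace G] [IsTopologicalGroup G] {I : Type*}

theorem exists_ncard_translates_le {Q₀ : Set G} {g : I → G} (hne : Q₀.Nonempty)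
    (hopen : IsOpen Q₀) {N : ℕ}
    (hN : ∀ i, {j | ((g i • Q₀) ∩ (g j • Q₀)).Nonempty}.Finite ∧
      {j | ((g i • Q₀) ∩ (g j • Q₀)).Nonempty}.ncard ≤ N)
    {K : Set G} (hK : IsCompact K) :
    ∃ M : ℕ, ∀ x : G, {i | x⁻¹ * g i ∈ K}.Finite ∧ {i | x⁻¹ * g i ∈ K}.ncard ≤ M := by
  obtain ⟨q, hq⟩ := hne
  have hW : {w : G × G | w.1⁻¹ * w.2 * q ∈ Q₀} ∈ nhds ((1, 1) : G × G) := by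
    refine (hopen.preimage (f := fun w : G × G => w.1⁻¹ * w.2 * q) (by fun_prop)).mem_nhds ?_
    simpa using hq
  rw [nhds_prod_eq, Filter.mem_prod_same_iff] at hW
  obtain ⟨V, hV, hVW⟩ := hW
  have key : ∀ y : G, {i | y⁻¹ * g i ∈ V}.Finite ∧ {i | y⁻¹ * g i ∈ V}.ncard ≤ N := by
    intro y
    rcases Set.eq_empty_or_nonempty {i | y⁻¹ * g i ∈ V} with h | ⟨i, hi⟩
    · simp [h]
    · have hsub : {j | y⁻¹ * g j ∈ V} ⊆ {j | ((g i • Q₀) ∩ (g j • Q₀)).Nonempty} := by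
        intro j hj
        have h1 : (y⁻¹ * g i)⁻¹ * (y⁻¹ * g j) * q ∈ Q₀ := hVW (Set.mk_mem_prod hi hj)
        refine ⟨g j * q, ?_, Set.smul_mem_smul_set hq⟩
        rw [Set.mem_smul_set_iff_inv_smul_mem]
        convert h1 using 1
        simp [mul_assoc]
      exact ⟨(hN i).1.subset hsub, (Set.ncard_le_ncard hsub (hN i).1).trans (hN i).2⟩
  obtain ⟨F, -, hF⟩ := hK.elim_nhds_subcover (fun p => (fun z => p⁻¹ * z) ⁻¹' V) (by
    intro p _
    refine (continuous_const_mul p⁻¹).continuousAt.preimage_mem_nhds ?_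
    simpa using hV)
  refine ⟨F.card * N, fun x => ?_⟩
  have hsub : {i | x⁻¹ * g i ∈ K} ⊆ ⋃ p ∈ F, {i | (x * p)⁻¹ * g i ∈ V} := by
    intro i hi
    obtain ⟨p, hp, h⟩ := Set.mem_iUnion₂.1 (hF hi)
    refine Set.mem_iUnion₂.2 ⟨p, hp, ?_⟩
    simpa [mul_assoc] using h
  have hfin : (⋃ p ∈ F, {i | (x * p)⁻¹ * g i ∈ V}).Finite :=
    F.finite_toSet.biUnion fun p _ => (key _).1
  refine ⟨hfin.subset hsub, (Set.ncard_le_ncard hsub hfin).trans ?_⟩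
  refine (Finset.set_ncard_biUnion_le F _).trans ?_
  rw [← smul_eq_mul]
  exact Finset.sum_le_card_nsmul _ _ _ fun p _ => (key _).2

theorem IsUniformCovering.exists_chain_le {U : I → Set G} (hU : IsUniformCovering U)
    {K : Set G} (hK : IsCompact K) (hK' : IsPreconnected K) (h1 : 1 ∈ K) :
    ∃ A : ℕ, ∀ x : G, ∀ κ ∈ K, ∃ k ≤ A, ChainExists U k x (x * κ) := by
  obtain ⟨⟨-, hcov, N, hN⟩, Q₀, g, hne, hopen, hsymm, hcpt, hUg⟩ := hU
  obtain rfl : U = fun i => g i • Q₀ := funext hUg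
  obtain ⟨M, hM⟩ := exists_ncard_translates_le (g := g) hne hopen hN (hK.mul hcpt)
  refine ⟨M, fun x κ hκ => ?_⟩
  have hsub : {i | ((g i • Q₀) ∩ (x • K)).Nonempty} ⊆ {i | x⁻¹ * g i ∈ K * closure Q₀} := by
    rintro i ⟨z, ⟨q, hq, rfl⟩, ⟨a, ha, h⟩⟩
    have h2 : q⁻¹ ∈ Q₀ := by rw [← hsymm]; simpa using hq
    refine ⟨a, ha, q⁻¹, subset_closure h2, ?_⟩
    simp only [smul_eq_mul] at h ⊢
    rw [mul_inv_eq_iff_eq_mul, mul_assoc, ← h]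
    simp
  have hpre : IsPreconnected (x • K) :=
    hK'.image _ (continuous_const_smul x).continuousOn
  obtain ⟨k, hk, hc⟩ := exists_chain_of_isPreconnected (Q := fun i => g i • Q₀)
    (fun i => hopen.smul (g i)) hcov hpre ((hM x).1.subset hsub)
    (x := x) (y := x * κ) ⟨1, h1, by simp⟩ ⟨κ, hκ, rfl⟩
  exact ⟨k, hk.trans ((Set.ncard_le_ncard hsub (hM x).1).trans (hM x).2), hc⟩

end UniformCovering

section SpecialLinear

instance : IsTopologicalGroup SL2R :=
  Matrix.SpecialLinearGroup.topologicalGroup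

theorem IsUniformCovering.exists_entry_bound {I : Type*} {U : I → Set SL2R}
    (hU : IsUniformCovering U) (k : ℕ) :
    ∃ B : ℝ, ∀ x y : SL2R, ChainExists U k x y → ∀ i j, |(x⁻¹ * y) i j| ≤ B := by
  obtain ⟨-, Q₀, g, -, -, hsymm, hcpt, hUg⟩ := hU
  have hmul : ∀ (β γ : ℝ) (x y : SL2R), (∀ i j, |x i j| ≤ β) → (∀ i j, |y i j| ≤ γ) →
      ∀ i j, |(x * y) i j| ≤ 2 * (β * γ) := by
    intro β γ x y hx hy i j
    have hβ : 0 ≤ β := (abs_nonneg _).trans (hx 0 0)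
    rw [Matrix.SpecialLinearGroup.coe_mul, Matrix.mul_apply, Fin.sum_univ_two]
    refine (abs_add_le _ _).trans ?_
    rw [abs_mul, abs_mul, two_mul]
    exact add_le_add (mul_le_mul (hx _ _) (hy _ _) (abs_nonneg _) hβ)
      (mul_le_mul (hx _ _) (hy _ _) (abs_nonneg _) hβ)
  have hbd : ∃ β : ℝ, ∀ x ∈ Q₀, ∀ i j, |x i j| ≤ β := by
    have hcont : ∀ i j, Continuous fun x : SL2R => x i j := fun i j =>
      (continuous_subtype_val (p := fun A : Matrix (Fin 2) (Fin 2) ℝ => A.det = 1)).matrix_elem i j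
    have h : ∀ i j, ∃ β : ℝ, ∀ x ∈ closure Q₀, ‖x i j‖ ≤ β := fun i j =>
      hcpt.exists_bound_of_continuousOn (hcont i j).continuousOn
    choose β hβ using h
    refine ⟨∑ i, ∑ j, |β i j|, fun x hx i j => ((hβ i j x (subset_closure hx)).trans
      (le_abs_self _)).trans ?_⟩
    refine (Finset.single_le_sum (f := fun j => |β i j|) (fun j _ => abs_nonneg _)
      (Finset.mem_univ j)).trans ?_
    exact Finset.single_le_sum (f := fun i => ∑ j, |β i j|)
      (fun i _ => Finset.sum_nonneg fun j _ => abs_nonneg _) (Finset.mem_univ i)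
  obtain ⟨β, hβ⟩ := hbd
  have hstep : ∀ (i : I) (x y : SL2R), x ∈ U i → y ∈ U i →
      ∀ a b, |(x⁻¹ * y) a b| ≤ 2 * (β * β) := by
    intro i x y hx hy
    rw [hUg] at hx hy
    obtain ⟨q, hq, rfl⟩ := hx
    obtain ⟨q', hq', rfl⟩ := hy
    have h2 : q⁻¹ ∈ Q₀ := by rw [← hsymm]; simpa using hq
    simpa [mul_assoc] using hmul β β q⁻¹ q' (hβ _ h2) (hβ _ hq')
  induction k with
  | zero => exact ⟨0, fun x y ⟨h, _⟩ => absurd h (lt_irrefl _)⟩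
  | succ k ih =>
    rcases k with _ | k
    · refine ⟨2 * (β * β), fun x y ⟨_, c, hx, hy, _⟩ => hstep _ x y hx hy⟩
    · obtain ⟨B, hB⟩ := ih
      refine ⟨2 * (B * (2 * (β * β))), fun x y h => ?_⟩
      obtain ⟨z, hz, i, hzi, hyi⟩ := h.exists_split
      have := hmul _ _ (x⁻¹ * z) (z⁻¹ * y) (hB x z hz) (hstep i z y hzi hyi)
      simpa [mul_assoc] using this

/-- The unipotent matrix with upper right entry `t`. -/
def unipotent (t : ℝ) : SL2R := ⟨!![1, t; 0, 1], by simp⟩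

/-- The diagonal matrix with entries `exp s` and `exp (-s)`. -/
noncomputable def diagExp (s : ℝ) : SL2R :=
  ⟨!![Real.exp s, 0; 0, Real.exp (-s)], by simp [← Real.exp_add]⟩

theorem diagExp_zero : diagExp 0 = 1 := by
  ext i j; fin_cases i <;> fin_cases j <;> simp [diagExp]

theorem unipotent_zero : unipotent 0 = 1 := by
  ext i j; fin_cases i <;> fin_cases j <;> simp [unipotent]

theorem diagExp_add (s t : ℝ) : diagExp (s + t) = diagExp s * diagExp t := by
  ext i j
  rw [Matrix.SpecialLinearGroup.coe_mul, Matrix.mul_apply, Fin.sum_univ_two]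
  fin_cases i <;> fin_cases j <;> simp [diagExp, Real.exp_add, mul_comm]

theorem unipotent_add (s t : ℝ) : unipotent (s + t) = unipotent s * unipotent t := by
  ext i j
  rw [Matrix.SpecialLinearGroup.coe_mul, Matrix.mul_apply, Fin.sum_univ_two]
  fin_cases i <;> fin_cases j <;> simp [unipotent, add_comm]

theorem diagExp_mul_unipotent_mul (s t : ℝ) :
    diagExp s * unipotent t * diagExp (-s) = unipotent (Real.exp (2 * s) * t) := by
  have h : Real.exp s * Real.exp (-s) = 1 := by rw [← Real.exp_add]; simp
  ext i j
  simp only [Matrix.SpecialLinearGroup.coe_mul, Matrix.mul_apply, Fin.sum_univ_two]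
  fin_cases i <;> fin_cases j <;> simp [diagExp, unipotent]
  · exact h
  · rw [two_mul, Real.exp_add]; ring
  · rw [mul_comm]; exact h

theorem unipotent_inv_mul (s t : ℝ) : (unipotent s)⁻¹ * unipotent t = unipotent (t - s) := by
  rw [inv_mul_eq_iff_eq_mul, ← unipotent_add]; congr 1; ring

theorem unipotent_injective : Function.Injective unipotent := by
  intro s t h
  have := congrArg (fun x : SL2R => x 0 1) h
  simpa [unipotent] using this

theorem continuous_diagExp_mul_unipotent :
    Continuous fun p : ℝ × ℝ => diagExp p.1 * unipotent p.2 := by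
  have h1 : Continuous diagExp := by
    refine Continuous.subtype_mk (p := fun A : Matrix (Fin 2) (Fin 2) ℝ => A.det = 1)
      (continuous_matrix fun i j => ?_) _
    fin_cases i <;> fin_cases j <;> simp <;> fun_prop
  have h2 : Continuous unipotent := by
    refine Continuous.subtype_mk (p := fun A : Matrix (Fin 2) (Fin 2) ℝ => A.det = 1)
      (continuous_matrix fun i j => ?_) _
    fin_cases i <;> fin_cases j <;> simp <;> fun_prop
  exact (h1.comp continuous_fst).mul (h2.comp continuous_snd)

theorem IsUniformCovering.exists_unipotent_chain {I : Type*} {U : I → Set SL2R}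
    (hU : IsUniformCovering U) :
    ∃ A : ℕ, ∀ (n : ℕ) (s t : ℝ), |t - s| ≤ Real.exp (2 * n) →
      ∃ k ≤ A * (2 * n + 1), ChainExists U k (unipotent s) (unipotent t) := by
  have hsq : IsCompact (Set.Icc (-1 : ℝ) 1 ×ˢ Set.Icc (-1 : ℝ) 1) :=
    isCompact_Icc.prod isCompact_Icc
  have hpre : IsPreconnected (Set.Icc (-1 : ℝ) 1 ×ˢ Set.Icc (-1 : ℝ) 1) :=
    isPreconnected_Icc.prod isPreconnected_Icc
  obtain ⟨A, hA⟩ := hU.exists_chain_le (hsq.image continuous_diagExp_mul_unipotent)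
    (hpre.image _ continuous_diagExp_mul_unipotent.continuousOn)
    ⟨(0, 0), by norm_num, by simp [diagExp_zero, unipotent_zero]⟩
  have hdiag : ∀ (s : ℝ), |s| ≤ 1 → ∀ (n : ℕ) (x : SL2R),
      n = 0 ∨ ∃ k ≤ A * n, ChainExists U k x (x * diagExp (s * n)) := by
    intro s hs n x
    induction n with
    | zero => exact Or.inl rfl
    | succ n ih =>
      right
      obtain ⟨k', hk', hc'⟩ := hA (x * diagExp (s * n)) (diagExp s)
        ⟨(s, 0), by simp [← abs_le, hs], by simp [unipotent_zero]⟩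
      have h : x * diagExp (s * n) * diagExp s = x * diagExp (s * (n + 1 : ℕ)) := by
        rw [mul_assoc, ← diagExp_add]; congr 2; push_cast; ring
      rw [h] at hc'
      rcases ih with rfl | ⟨k, hk, hc⟩
      · refine ⟨k', by simpa using hk', ?_⟩
        simpa [diagExp_zero] using hc'
      · exact ⟨k + k', by rw [mul_add]; omega, hc.trans hc'⟩
  refine ⟨A, fun n s t hst => ?_⟩
  have hu : |Real.exp (-(2 * n)) * (t - s)| ≤ 1 := by
    rw [abs_mul, abs_of_pos (Real.exp_pos _), Real.exp_neg]
    exact (inv_mul_le_one₀ (Real.exp_pos _)).2 hst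
  set v := Real.exp (-(2 * n)) * (t - s) with hv
  have hend : unipotent s * diagExp (1 * n) * unipotent v * diagExp ((-1) * n) = unipotent t := by
    have := diagExp_mul_unipotent_mul n v
    rw [one_mul, neg_one_mul, mul_assoc, mul_assoc, ← mul_assoc (diagExp _), this,
      ← unipotent_add]
    congr 1
    rw [hv, ← mul_assoc, ← Real.exp_add]
    simp
  obtain ⟨k₂, hk₂, h₂⟩ := hA (unipotent s * diagExp (1 * n)) (unipotent v)
    ⟨(0, v), by simp [← abs_le, hu], by simp [diagExp_zero]⟩
  rcases hdiag 1 (by norm_num) n (unipotent s) with rfl | ⟨k₁, hk₁, h₁⟩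
  · refine ⟨k₂, by simpa using hk₂, ?_⟩
    rw [← hend]
    simpa [diagExp_zero] using h₂
  rcases hdiag (-1) (by norm_num) n (unipotent s * diagExp (1 * n) * unipotent v) with
    rfl | ⟨k₃, hk₃, h₃⟩
  · refine ⟨k₂, by simpa using hk₂, ?_⟩
    rw [← hend]
    simpa [diagExp_zero] using h₂
  rw [hend] at h₃
  refine ⟨k₁ + k₂ + k₃, ?_, (h₁.trans h₂).trans h₃⟩
  have : A * (2 * n + 1) = A * n + A + A * n := by ring
  omega

end SpecialLinear

section Growth

/-- Balls of radius `n` for the covering `Q` are covered by polynomially many members of `Q`. -/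
def HasPolynomialGrowth {Z J : Type*} (Q : J → Set Z) : Prop :=
  ∀ z : Z, ∃ c D : ℕ, ∀ n : ℕ, ∃ F : Finset J, F.card ≤ c * (n + 1) ^ D ∧
    ∀ k ≤ n, ∀ y, ChainExists Q k z y → ∃ j ∈ F, y ∈ Q j

theorem exists_poly_lt_two_pow (c D W n₀ : ℕ) :
    ∃ n ≥ n₀, c * (W * (2 * n + 2) + 1) ^ D < 2 ^ n := by
  have h := tendsto_pow_const_div_const_pow_of_one_lt D (r := (2 : ℝ)) (by norm_num)
  have hpos : (0 : ℝ) < 1 / ((c + 1) * (4 * W + 1) ^ D) := by positivity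
  obtain ⟨n, ⟨hn, hn₀⟩, hn1⟩ := (((h.eventually_lt_const hpos).and
    (Filter.eventually_ge_atTop n₀)).and (Filter.eventually_ge_atTop 1)).exists
  refine ⟨n, hn₀, ?_⟩
  rw [div_lt_div_iff₀ (by positivity) (by positivity), one_mul] at hn
  have h1 : n ^ D * ((c + 1) * (4 * W + 1) ^ D) < 2 ^ n := by exact_mod_cast hn
  refine lt_of_le_of_lt ?_ h1
  have h2 : W * (2 * n + 2) + 1 ≤ n * (4 * W + 1) := by nlinarith
  calc c * (W * (2 * n + 2) + 1) ^ D ≤ (c + 1) * (n * (4 * W + 1)) ^ D := by gcongr; omega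
    _ = n ^ D * ((c + 1) * (4 * W + 1) ^ D) := by rw [mul_pow]; ring

theorem HasPolynomialGrowth.not_isQIEmbedding {I Z J : Type*} {Q : J → Set Z}
    (hQ : HasPolynomialGrowth Q) {U : I → Set SL2R} (hU : IsUniformCovering U) (f : SL2R → Z) :
    ¬ IsQIEmbedding (coveredDist U) (coveredDist Q) f := by
  rintro ⟨L, C, hL, hC, hf⟩
  set R : ℕ := ⌈L * (1 + C)⌉₊ with hR
  choose B hB using hU.exists_entry_bound
  obtain ⟨A, hA⟩ := hU.exists_unipotent_chain
  obtain ⟨m, hm⟩ := exists_nat_gt (∑ k ∈ Finset.range (R + 1), |B k|)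
  have hm0 : (0 : ℝ) < m := (Finset.sum_nonneg fun k _ => abs_nonneg _).trans_lt hm
  have hsep : ∀ i j : ℕ, i ≠ j → ∀ k ≤ R,
      ¬ ChainExists U k (unipotent (m * i)) (unipotent (m * j)) := by
    intro i j hij k hk hc
    have h1 := hB k _ _ hc 0 1
    rw [unipotent_inv_mul] at h1
    have h2 : B k < m := by
      refine (le_abs_self _).trans_lt (lt_of_le_of_lt ?_ hm)
      exact Finset.single_le_sum (f := fun k => |B k|) (fun k _ => abs_nonneg _)
        (Finset.mem_range.2 (by omega))
    have h3 : (1 : ℝ) ≤ |(j : ℝ) - i| := by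
      have : (1 : ℤ) ≤ |(j : ℤ) - i| := Int.one_le_abs (by omega)
      exact_mod_cast this
    have h4 : |(m * j - m * i : ℝ)| ≤ B k := by simpa [unipotent] using h1
    rw [← mul_sub, abs_mul, abs_of_pos hm0] at h4
    nlinarith
  have hlow : ∀ i j : ℕ, i ≠ j →
      1 < coveredDist Q (f (unipotent (m * i))) (f (unipotent (m * j))) := by
    intro i j hij
    obtain ⟨n, hn⟩ := exists_nat_gt |(m * j - m * i : ℝ)|
    obtain ⟨k, -, hk⟩ := hA n (m * i) (m * j) (by
      refine hn.le.trans ?_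
      have := Real.add_one_le_exp (2 * n : ℝ)
      have : (0 : ℝ) ≤ n := by positivity
      linarith)
    have hne : unipotent (m * i) ≠ unipotent (m * j) := by
      intro h
      have := mul_left_cancel₀ hm0.ne' (unipotent_injective h)
      exact hij (by exact_mod_cast this)
    have h1 := lt_coveredDist hne hk (hsep i j hij)
    have h2 : L * (1 + C) < coveredDist U (unipotent (m * i)) (unipotent (m * j)) :=
      (Nat.le_ceil _).trans_lt h1
    have h3 := (hf (unipotent (m * i)) (unipotent (m * j))).1
    have h4 : 1 + C < 1 / L * coveredDist U (unipotent (m * i)) (unipotent (m * j)) := by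
      rw [one_div, ← div_eq_inv_mul, lt_div_iff₀ hL]; linarith
    linarith
  obtain ⟨W, hW⟩ := exists_nat_ge (max (L * A) C)
  obtain ⟨c, D, hcD⟩ := hQ (f (unipotent (m * (0 : ℕ))))
  obtain ⟨n, hn, hlt⟩ := exists_poly_lt_two_pow c D W m
  obtain ⟨F, hF, hFc⟩ := hcD (W * (2 * n + 2))
  have hmem : ∀ j ∈ Finset.Icc 1 (2 ^ n), ∃ a ∈ F, f (unipotent (m * (j : ℕ))) ∈ Q a := by
    intro j hj
    rw [Finset.mem_Icc] at hj
    obtain ⟨k, hk, hkc⟩ := exists_chain_of_coveredDist_pos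
      (one_pos.trans (hlow 0 j (by omega)))
    refine hFc k ?_ _ hkc
    obtain ⟨k', hk', hc'⟩ := hA n (m * (0 : ℕ)) (m * j) (by
      have h1 : m * j ≤ 4 ^ n := by
        calc m * j ≤ 2 ^ n * 2 ^ n :=
              Nat.mul_le_mul (hn.trans Nat.lt_two_pow_self.le) hj.2
          _ = 4 ^ n := by rw [← mul_pow]; norm_num
      have h2 : (4 : ℝ) ^ n ≤ Real.exp (2 * n) := by
        have h3 : (4 : ℝ) ≤ Real.exp 2 := by
          have := Real.add_one_le_exp (1 : ℝ)
          have h5 : Real.exp 2 = Real.exp 1 * Real.exp 1 := by rw [← Real.exp_add]; norm_num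
          nlinarith
        calc (4 : ℝ) ^ n ≤ Real.exp 2 ^ n := by gcongr
          _ = Real.exp (2 * n) := by rw [← Real.exp_nat_mul, mul_comm]
      have h4 : (m : ℝ) * j ≤ 4 ^ n := by exact_mod_cast h1
      rw [Nat.cast_zero, mul_zero, sub_zero, abs_of_nonneg (by positivity)]
      exact h4.trans h2)
    have h1 := (hf (unipotent (m * (0 : ℕ))) (unipotent (m * j))).2
    rw [← hk] at h1
    have h2 := coveredDist_le hc'
    have h3 : (k' : ℝ) ≤ A * (2 * n + 1) := by exact_mod_cast hk'
    have h4 : (k : ℝ) ≤ W * (2 * n + 2) := by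
      calc (k : ℝ) ≤ L * (A * (2 * n + 1)) + C := h1.trans (by gcongr; exact h2.trans h3)
        _ = (L * A) * (2 * n + 1) + C := by ring
        _ ≤ W * (2 * n + 1) + W := by
          gcongr
          · exact (le_max_left _ _).trans hW
          · exact (le_max_right _ _).trans hW
        _ = W * (2 * n + 2) := by ring
    exact_mod_cast h4
  have hmem' : ∀ j, ∃ a, j ∈ Finset.Icc 1 (2 ^ n) →
      a ∈ F ∧ f (unipotent (m * (j : ℕ))) ∈ Q a := by
    intro j
    by_cases hj : j ∈ Finset.Icc 1 (2 ^ n)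
    · obtain ⟨a, ha⟩ := hmem j hj
      exact ⟨a, fun _ => ha⟩
    · obtain ⟨a, -⟩ := hmem 1 (Finset.mem_Icc.2 ⟨le_rfl, Nat.one_le_two_pow⟩)
      exact ⟨a, fun h => absurd h hj⟩
  choose a ha using hmem'
  have hcard := Finset.card_le_card_of_injOn (s := Finset.Icc 1 (2 ^ n)) (t := F) a
    (fun j hj => (ha j hj).1) (by
    intro i hi j hj hij
    by_contra hne
    have h1 := coveredDist_le (chainExists_one (a i) (ha i hi).2 (by rw [hij]; exact (ha j hj).2))
    have h2 := hlow i j hne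
    norm_num at h1
    linarith)
  rw [Nat.card_Icc] at hcard
  omega

theorem hasPolynomialGrowth_uniformCovering (k : ℕ) :
    HasPolynomialGrowth (uniformCovering k) := by
  intro z
  refine ⟨3 ^ k, k, fun n =>
    ⟨Fintype.piFinset fun i => Finset.Icc (⌊z i⌋ - (n + 1)) (⌊z i⌋ + n), ?_, ?_⟩⟩
  · rw [Fintype.card_piFinset]
    simp only [Int.card_Icc]
    rw [Finset.prod_congr rfl (g := fun _ => 2 * n + 2) (fun i _ => by omega)]
    rw [Finset.prod_const, Finset.card_univ, Fintype.card_fin, ← mul_pow]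
    gcongr
    omega
  · intro k' hk' y hc
    obtain ⟨h0, c, hz, hy, hc⟩ := chainExists_iff_nat.1 hc
    refine ⟨_, Fintype.mem_piFinset.2 fun i => ?_, hy⟩
    have hstart : ⌊z i⌋ - 1 ≤ c 0 i ∧ c 0 i ≤ ⌊z i⌋ := by
      obtain ⟨h1, h2⟩ := hz i
      refine ⟨?_, Int.le_floor.2 h1⟩
      have : (⌊z i⌋ : ℝ) ≤ c 0 i + 1 := (Int.floor_le _).trans h2
      have : ⌊z i⌋ ≤ c 0 i + 1 := by exact_mod_cast this
      omega
    have hstep : ∀ l, l < k' → ⌊z i⌋ - 1 - l ≤ c l i ∧ c l i ≤ ⌊z i⌋ + l := by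
      intro l
      induction l with
      | zero => intro; simpa using hstart
      | succ l ih =>
        intro hl
        obtain ⟨p, hp, hp'⟩ := hc l hl
        obtain ⟨h1, h2⟩ := hp i
        obtain ⟨h3, h4⟩ := hp' i
        have h5 : c l i ≤ c (l + 1) i + 1 := by exact_mod_cast h1.trans h4
        have h6 : c (l + 1) i ≤ c l i + 1 := by exact_mod_cast h3.trans h2
        have := ih (by omega)
        push_cast
        omega
    have := hstep (k' - 1) (by omega)
    rw [Finset.mem_Icc]
    omega

theorem hasPolynomialGrowth_dyadicCovering (r : ℕ) :
    HasPolynomialGrowth (dyadicCovering r) := by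
  have hle : ∀ (m : ℕ) (x : EuclideanSpace ℝ (Fin r)), x ∈ dyadicCovering r m →
      ‖x‖ ≤ 2 ^ (m + 1) := by
    intro m x hx
    unfold dyadicCovering at hx
    split_ifs at hx with h
    · subst h; simpa using hx
    · exact hx.2
  have hge : ∀ (m : ℕ) (x : EuclideanSpace ℝ (Fin r)), x ∈ dyadicCovering r (m + 1) →
      2 ^ m ≤ ‖x‖ := by
    intro m x hx
    simpa using hx.1
  intro z
  obtain ⟨M, hM⟩ := pow_unbounded_of_one_lt ‖z‖ (one_lt_two (α := ℝ))
  refine ⟨M + 3, 1, fun n => ⟨Finset.range (M + 2 * n + 1), ?_, ?_⟩⟩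
  · rw [Finset.card_range, pow_one]
    nlinarith
  · intro k' hk' y hc
    obtain ⟨h0, c, hz, hy, hc⟩ := chainExists_iff_nat.1 hc
    refine ⟨_, ?_, hy⟩
    have hstep : ∀ l, l < k' → c l ≤ M + 2 * l := by
      intro l
      induction l with
      | zero =>
        intro
        by_contra! h
        obtain ⟨m, hm⟩ : ∃ m, c 0 = m + 1 := ⟨c 0 - 1, by omega⟩
        rw [hm] at hz
        have h1 := (hge m z hz).trans_lt hM
        have := (pow_lt_pow_iff_right₀ (one_lt_two (α := ℝ))).1 h1
        omega
      | succ l ih =>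
        intro hl
        obtain ⟨p, hp, hp'⟩ := hc l hl
        have h1 := ih (by omega)
        by_contra! h
        obtain ⟨m, hm⟩ : ∃ m, c (l + 1) = m + 1 := ⟨c (l + 1) - 1, by omega⟩
        rw [hm] at hp'
        have h1 := (hge m p hp').trans (hle _ p hp)
        have := (pow_le_pow_iff_right₀ (one_lt_two (α := ℝ))).1 h1
        omega
    have := hstep (k' - 1) (by omega)
    rw [Finset.mem_range]
    omega

theorem heisCover_inter {n : ℕ} {γ γ' : HeisInt n}
    (h : (heisCover n γ ∩ heisCover n γ').Nonempty) :
    (∀ i, |γ'.1 i| ≤ |γ.1 i| + 1) ∧ (∀ i, |γ'.2.1 i| ≤ |γ.2.1 i| + 1) ∧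
      |γ'.2.2| ≤ |γ.2.2| + 1 + ∑ i, (|γ.1 i| + |γ'.1 i|) := by
  obtain ⟨_, ⟨p, ⟨hp1, hp2, hp3⟩, rfl⟩, ⟨q, ⟨hq1, hq2, hq3⟩, hpq⟩⟩ := h
  simp only [heisMul, heisEmbed, Prod.mk.injEq] at hpq
  obtain ⟨e1, e2, e3⟩ := hpq
  have habs : ∀ (u v : ℤ) (s t : ℝ), s ∈ Set.Icc (0 : ℝ) 1 → t ∈ Set.Icc (0 : ℝ) 1 →
      (v : ℝ) + t = u + s → |v| ≤ |u| + 1 := by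
    intro u v s t hs ht h
    have h1 : |(v : ℝ) - u| ≤ 1 := by
      rw [abs_le]; constructor <;> linarith [hs.1, hs.2, ht.1, ht.2]
    have h2 : |v - u| ≤ 1 := by exact_mod_cast h1
    have := abs_sub_abs_le_abs_sub v u
    omega
  refine ⟨fun i => habs _ _ _ _ (hp1 i) (hq1 i) (congrFun e1 i),
    fun i => habs _ _ _ _ (hp2 i) (hq2 i) (congrFun e2 i), ?_⟩
  have hsum : ∀ (u : Fin n → ℤ) (s : Fin n → ℝ), (∀ i, s i ∈ Set.Icc (0 : ℝ) 1) →
      |∑ i, (u i : ℝ) * s i| ≤ ∑ i, |(u i : ℝ)| := by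
    intro u s hs
    refine (Finset.abs_sum_le_sum_abs _ _).trans (Finset.sum_le_sum fun i _ => ?_)
    rw [abs_mul, abs_of_nonneg (hs i).1]
    exact mul_le_of_le_one_right (abs_nonneg _) (hs i).2
  have h1 := abs_le.1 (hsum γ.1 _ hp2)
  have h2 := abs_le.1 (hsum γ'.1 _ hq2)
  have h3 : |(γ'.2.2 : ℝ) - γ.2.2| ≤ 1 + ∑ i, (|(γ.1 i : ℝ)| + |(γ'.1 i : ℝ)|) := by
    rw [Finset.sum_add_distrib, abs_le]
    constructor <;> linarith [hp3.1, hp3.2, hq3.1, hq3.2]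
  have h4 : |γ'.2.2 - γ.2.2| ≤ 1 + ∑ i, (|γ.1 i| + |γ'.1 i|) := by exact_mod_cast h3
  have := abs_sub_abs_le_abs_sub γ'.2.2 γ.2.2
  linarith

theorem hasPolynomialGrowth_heisCover (n : ℕ) : HasPolynomialGrowth (heisCover n) := by
  intro z
  obtain ⟨M, hM⟩ : ∃ M : ℕ, ∀ γ : HeisInt n, z ∈ heisCover n γ →
      (∀ i, |γ.1 i| ≤ M) ∧ (∀ i, |γ.2.1 i| ≤ M) ∧ |γ.2.2| ≤ M := by
    by_cases h : ∃ γ₀, z ∈ heisCover n γ₀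
    · obtain ⟨γ₀, h₀⟩ := h
      set S : ℤ := ∑ i, |γ₀.1 i| with hS
      set T : ℤ := ∑ i, |γ₀.2.1 i| with hT
      have hS0 : 0 ≤ S := Finset.sum_nonneg fun i _ => abs_nonneg _
      have hT0 : 0 ≤ T := Finset.sum_nonneg fun i _ => abs_nonneg _
      have hi1 : ∀ i, |γ₀.1 i| ≤ S := fun i =>
        Finset.single_le_sum (f := fun i => |γ₀.1 i|) (fun i _ => abs_nonneg _) (Finset.mem_univ i)
      have hi2 : ∀ i, |γ₀.2.1 i| ≤ T := fun i =>
        Finset.single_le_sum (f := fun i => |γ₀.2.1 i|) (fun i _ => abs_nonneg _)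
          (Finset.mem_univ i)
      refine ⟨(S + T + 2 * S + n + 1 + |γ₀.2.2|).toNat, fun γ hγ => ?_⟩
      have hc := abs_nonneg γ₀.2.2
      rw [Int.toNat_of_nonneg (by positivity)]
      obtain ⟨h1, h2, h3⟩ := heisCover_inter ⟨z, h₀, hγ⟩
      refine ⟨fun i => ?_, fun i => ?_, ?_⟩
      · have := h1 i; have := hi1 i; omega
      · have := h2 i; have := hi2 i; omega
      · have h4 : ∑ i, (|γ₀.1 i| + |γ.1 i|) ≤ 2 * S + n := by
          calc ∑ i, (|γ₀.1 i| + |γ.1 i|) ≤ ∑ i, (|γ₀.1 i| + (|γ₀.1 i| + 1)) :=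
                Finset.sum_le_sum fun i _ => by have := h1 i; omega
            _ = 2 * S + n := by
              rw [Finset.sum_add_distrib, Finset.sum_add_distrib]; simp; ring
        omega
    · exact ⟨0, fun γ hγ => absurd ⟨γ, hγ⟩ h⟩
  obtain ⟨E, hE⟩ : ∃ E : ℕ → ℕ, E = fun m => (M + 1) * (2 * n + 2) * (m + 1) ^ 2 := ⟨_, rfl⟩
  refine ⟨(3 * ((M + 1) * (2 * n + 2))) ^ (2 * n + 1), 2 * (2 * n + 1), fun m =>
    ⟨(Fintype.piFinset fun _ => Finset.Icc (-(E m : ℤ)) (E m)) ×ˢ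
      (Fintype.piFinset fun _ => Finset.Icc (-(E m : ℤ)) (E m)) ×ˢ
      Finset.Icc (-(E m : ℤ)) (E m), ?_, ?_⟩⟩
  · rw [Finset.card_product, Finset.card_product, Fintype.card_piFinset_const, Int.card_Icc]
    have h1 : ((E m : ℤ) + 1 - -(E m : ℤ)).toNat = 2 * E m + 1 := by omega
    have h2 : 1 ≤ E m := by rw [hE]; exact Nat.one_le_iff_ne_zero.2 (by positivity)
    rw [h1, pow_mul, ← mul_pow]
    calc (2 * E m + 1) ^ n * ((2 * E m + 1) ^ n * (2 * E m + 1))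
        = (2 * E m + 1) ^ (2 * n + 1) := by ring
      _ ≤ (3 * E m) ^ (2 * n + 1) := by gcongr; omega
      _ = _ := by rw [hE]; ring
  · intro k hk y hc
    obtain ⟨h0, c, hz, hy, hc⟩ := chainExists_iff_nat.1 hc
    have hstep : ∀ l, l < k → (∀ i, |(c l).1 i| ≤ M + l) ∧ (∀ i, |(c l).2.1 i| ≤ M + l) ∧
        |(c l).2.2| ≤ M + l * (1 + n * (2 * (M + l))) := by
      intro l
      induction l with
      | zero => intro; simpa using hM _ hz
      | succ l ih =>
        intro hl
        obtain ⟨h1, h2, h3⟩ := ih (by omega)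
        obtain ⟨h4, h5, h6⟩ := heisCover_inter (hc l hl)
        refine ⟨fun i => ?_, fun i => ?_, ?_⟩
        · have := h1 i; have := h4 i; push_cast; omega
        · have := h2 i; have := h5 i; push_cast; omega
        · have h7 : ∑ i, (|(c l).1 i| + |(c (l + 1)).1 i|) ≤ n * (2 * (M + (l + 1 : ℕ))) := by
            calc ∑ i, (|(c l).1 i| + |(c (l + 1)).1 i|)
                ≤ ∑ _i : Fin n, (2 * (M + (l + 1 : ℕ)) : ℤ) :=
                  Finset.sum_le_sum fun i _ => by
                    have := h1 i; have := h4 i; push_cast; omega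
              _ = _ := by simp
          have h8 : (l * (1 + n * (2 * (M + l))) : ℤ) ≤ l * (1 + n * (2 * (M + (l + 1 : ℕ)))) := by
            gcongr; omega
          have h9 : (((l + 1 : ℕ) : ℤ) * (1 + n * (2 * (M + (l + 1 : ℕ))))) =
            l * (1 + n * (2 * (M + (l + 1 : ℕ)))) + (1 + n * (2 * (M + (l + 1 : ℕ)))) := by
            push_cast; ring
          linarith
    obtain ⟨h1, h2, h3⟩ := hstep (k - 1) (by omega)
    have hkm : k - 1 ≤ m := by omega
    have hE1 : M + (k - 1) ≤ E m := by
      rw [hE]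
      calc M + (k - 1) ≤ M + m := by omega
        _ ≤ (M + 1) * (2 * n + 2) * (m + 1) ^ 2 := by
          nlinarith [Nat.zero_le (M * m), Nat.zero_le (M * n * (m + 1) ^ 2),
            Nat.zero_le (n * (m + 1) ^ 2), Nat.zero_le (M * m ^ 2)]
    have hE2 : M + (k - 1) * (1 + n * (2 * (M + (k - 1)))) ≤ E m := by
      rw [hE]
      calc M + (k - 1) * (1 + n * (2 * (M + (k - 1)))) ≤ M + m * (1 + n * (2 * (M + m))) := by
            gcongr
        _ ≤ (M + 1) * (2 * n + 2) * (m + 1) ^ 2 := by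
            have : M + m ≤ (M + 1) * (m + 1) := by nlinarith
            calc M + m * (1 + n * (2 * (M + m)))
                ≤ (M + 1) * (m + 1) * (m + 1) + (m + 1) * (1 + n * (2 * ((M + 1) * (m + 1)))) := by
                  gcongr
                  · nlinarith [Nat.zero_le (M * m), Nat.zero_le (M * m * m)]
                  · omega
              _ ≤ _ := by nlinarith [Nat.zero_le (M * (m + 1) ^ 2), Nat.zero_le (m * (m + 1))]
    have hE1' : (M + (k - 1 : ℕ) : ℤ) ≤ E m := by exact_mod_cast hE1
    have hE2' : (M + (k - 1 : ℕ) * (1 + n * (2 * (M + (k - 1 : ℕ)))) : ℤ) ≤ E m := by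
      exact_mod_cast hE2
    refine ⟨_, ?_, hy⟩
    simp only [Finset.mem_product, Fintype.mem_piFinset, Finset.mem_Icc, ← abs_le]
    exact ⟨fun i => (h1 i).trans hE1', fun i => (h2 i).trans hE1', h3.trans hE2'⟩

end Growth

/-- Let `U` be any uniform covering of `SL(2,ℝ)` with associated metric `d_U`.
Then for all `k, l, r ≥ 1` there is no quasi-isometric embedding from `(SL(2,ℝ), d_U)` to
`(ℝᵏ, d_{U(ℝᵏ)})`, none to `(ℝ^{2l+1}, d_{P_l})`, and none to `(ℝʳ, d_{B(ℝʳ)})`. -/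
theorem statement16 {I : Type*} (U : I → Set SL2R) (hU : IsUniformCovering U)
    (k l r : ℕ) (hk : 1 ≤ k) (hl : 1 ≤ l) (hr : 1 ≤ r) :
    (¬ ∃ f : SL2R → (Fin k → ℝ),
        IsQIEmbedding (coveredDist U) (coveredDist (uniformCovering k)) f) ∧
    (¬ ∃ f : SL2R → HeisReal l,
        IsQIEmbedding (coveredDist U) (coveredDist (heisCover l)) f) ∧
    ¬ ∃ f : SL2R → EuclideanSpace ℝ (Fin r),
        IsQIEmbedding (coveredDist U) (coveredDist (dyadicCovering r)) f := by
  exact ⟨fun ⟨f, hf⟩ => (hasPolynomialGrowth_uniformCovering k).not_isQIEmbedding hU f hf,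
    fun ⟨f, hf⟩ => (hasPolynomialGrowth_heisCover l).not_isQIEmbedding hU f hf,
    fun ⟨f, hf⟩ => (hasPolynomialGrowth_dyadicCovering r).not_isQIEmbedding hU f hf⟩
end

section
/- For every n ≥ 1, the map φ : ℝⁿ → [0,∞) defined by φ(x) = ‖x‖₂ⁿ is a surjective quasi-isometric embedding (hence a quasi-isometry) from (ℝⁿ, d_{B(ℝⁿ)}) to ([0,∞), d_{B⁺}), where B⁺ is the dyadic covering of [0,∞). -/
open Set Pointwise MeasureTheory
open scoped Classical

/-- The dyadic covering `B⁺` of `[0,∞)`: `D₀⁺ = [0,2]` and `D_m⁺ = [2^{m−1}, 2^{m+1}]`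
for `m ≥ 1`. -/
def dyadicCoveringNN : ℕ → Set NNReal :=
  fun m => if m = 0 then {x | x ≤ 2}
           else {x | (2 : NNReal) ^ (m - 1) ≤ x ∧ x ≤ (2 : NNReal) ^ (m + 1)}

/-- The dyadic level of a nonnegative real: `0` on `[0, 2)` and `m` on `[2 ^ m, 2 ^ (m + 1))`. -/
noncomputable def dyadicLevel (r : NNReal) : ℕ := Nat.log 2 ⌊r⌋₊

lemma le_dyadicLevel {r : NNReal} {m : ℕ} (h : 2 ^ m ≤ r) : m ≤ dyadicLevel r := by
  apply Nat.le_log_of_pow_le (by norm_num)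
  apply Nat.le_floor
  exact_mod_cast h

lemma dyadicLevel_lt {r : NNReal} {m : ℕ} (hm : m ≠ 0) (h : r < 2 ^ m) : dyadicLevel r < m := by
  apply Nat.log_lt_of_lt_pow' hm
  rw [Nat.floor_lt zero_le]
  exact_mod_cast h

lemma two_pow_dyadicLevel_le {r : NNReal} (h : 1 ≤ r) : 2 ^ dyadicLevel r ≤ r := by
  have h1 : 2 ^ dyadicLevel r ≤ ⌊r⌋₊ :=
    Nat.pow_log_le_self 2 (Nat.floor_pos.2 h).ne'
  have h2 := (Nat.le_floor_iff zero_le).1 h1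
  exact_mod_cast h2

lemma lt_two_pow_dyadicLevel_succ (r : NNReal) : r < 2 ^ (dyadicLevel r + 1) := by
  by_contra! h
  have := le_dyadicLevel h
  omega

lemma mem_dyadicCoveringNN_dyadicLevel (r : NNReal) : r ∈ dyadicCoveringNN (dyadicLevel r) := by
  have h2 := lt_two_pow_dyadicLevel_succ r
  unfold dyadicCoveringNN
  split_ifs with h
  · simpa [h] using h2.le
  · refine ⟨?_, h2.le⟩
    have h1 : 1 ≤ r := by
      by_contra! h1
      have : r < 2 ^ 1 := h1.trans (by norm_num)
      have := dyadicLevel_lt one_ne_zero this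
      omega
    exact (pow_le_pow_right₀ (by norm_num) (Nat.sub_le _ 1)).trans (two_pow_dyadicLevel_le h1)

lemma dyadicLevel_bounds_of_mem {r : NNReal} {m : ℕ} (h : r ∈ dyadicCoveringNN m) :
    m ≤ dyadicLevel r + 1 ∧ dyadicLevel r ≤ m + 1 := by
  have key : r ≤ 2 ^ (m + 1) → dyadicLevel r ≤ m + 1 := fun h => by
    have : r < 2 ^ (m + 2) :=
      h.trans_lt (pow_lt_pow_right₀ (by norm_num) (by omega))
    have := dyadicLevel_lt (by omega) this
    omega
  unfold dyadicCoveringNN at h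
  split_ifs at h with hm
  · subst hm
    exact ⟨by omega, key (by simpa using h)⟩
  · have := le_dyadicLevel h.1
    exact ⟨by omega, key h.2⟩

lemma two_pow_succ_mem_dyadicCoveringNN (m : ℕ) : 2 ^ (m + 1) ∈ dyadicCoveringNN m := by
  unfold dyadicCoveringNN
  split_ifs with h
  · simp [h]
  · exact ⟨pow_le_pow_right₀ (by norm_num) (by omega), le_rfl⟩

lemma two_pow_mem_dyadicCoveringNN_succ (m : ℕ) : 2 ^ (m + 1) ∈ dyadicCoveringNN (m + 1) := by
  unfold dyadicCoveringNN
  rw [if_neg (by omega)]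
  exact ⟨pow_le_pow_right₀ (by norm_num) (by omega), pow_le_pow_right₀ (by norm_num) (by omega)⟩

lemma dyadicLevel_pow_bounds (r : NNReal) {n : ℕ} (hn : 1 ≤ n) :
    n * dyadicLevel r ≤ dyadicLevel (r ^ n) ∧ dyadicLevel (r ^ n) ≤ n * dyadicLevel r + n := by
  constructor
  · by_cases h : 1 ≤ r
    · apply le_dyadicLevel
      rw [mul_comm, pow_mul]
      exact pow_le_pow_left₀ zero_le (two_pow_dyadicLevel_le h) n
    · have : r < 2 ^ 1 := (not_le.1 h).trans (by norm_num)
      have := dyadicLevel_lt one_ne_zero this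
      have h0 : dyadicLevel r = 0 := by omega
      simp [h0]
  · have h : r ^ n < 2 ^ (n * dyadicLevel r + n) := by
      have := pow_lt_pow_left₀ (lt_two_pow_dyadicLevel_succ r) zero_le (by omega : n ≠ 0)
      rwa [← pow_mul, mul_comm, mul_add, mul_one] at this
    exact (dyadicLevel_lt (by omega) h).le

lemma ChainExists.symm {X I : Type*} {Q : I → Set X} {k : ℕ} {x y : X}
    (h : ChainExists Q k x y) : ChainExists Q k y x := by
  obtain ⟨hk, c, hx, hy, hc⟩ := h
  refine ⟨hk, fun i => c i.rev, ?_, ?_, fun l hl => ?_⟩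
  · convert hy using 3
    ext
    simp only [Fin.val_rev]
  · convert hx using 3
    ext
    simp only [Fin.val_rev]
    omega
  · have := hc (k - 2 - l) (by omega)
    rw [inter_comm] at this
    convert this using 4 <;> simp only [Fin.rev, Fin.mk.injEq] <;> omega

section DyadicPullback

variable {X : Type*} {N : X → NNReal}

lemma chainExists_of_dyadicLevel_le (hN : Function.Surjective N) {x y : X}
    (h : dyadicLevel (N x) ≤ dyadicLevel (N y)) :
    ChainExists (fun m => N ⁻¹' dyadicCoveringNN m)
      (dyadicLevel (N y) - dyadicLevel (N x) + 1) x y := by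
  refine ⟨by omega, fun i => dyadicLevel (N x) + i, ?_, ?_, fun l _ => ?_⟩
  · exact mem_dyadicCoveringNN_dyadicLevel _
  · have : dyadicLevel (N x) + (dyadicLevel (N y) - dyadicLevel (N x) + 1 - 1)
        = dyadicLevel (N y) := by omega
    simp only [this]
    exact mem_dyadicCoveringNN_dyadicLevel _
  · obtain ⟨z, hz⟩ := hN (2 ^ (dyadicLevel (N x) + l + 1))
    refine ⟨z, ?_, ?_⟩
    · simpa only [mem_preimage, hz] using two_pow_succ_mem_dyadicCoveringNN _
    · simpa only [mem_preimage, hz, ← add_assoc] using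
        two_pow_mem_dyadicCoveringNN_succ (dyadicLevel (N x) + l)

lemma dyadicLevel_le_of_chainExists {k : ℕ} {x y : X}
    (h : ChainExists (fun m => N ⁻¹' dyadicCoveringNN m) k x y) :
    dyadicLevel (N y) ≤ dyadicLevel (N x) + 2 * k := by
  obtain ⟨hk, c, hx, hy, hc⟩ := h
  have key : ∀ (l : ℕ) (hl : l < k), c ⟨l, hl⟩ ≤ dyadicLevel (N x) + 1 + 2 * l := by
    intro l
    induction l with
    | zero => exact fun _ => (dyadicLevel_bounds_of_mem hx).1
    | succ l ih =>
      intro hl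
      obtain ⟨z, hz₁, hz₂⟩ := hc l hl
      have h₁ := (dyadicLevel_bounds_of_mem hz₁).2
      have h₂ := (dyadicLevel_bounds_of_mem hz₂).1
      have := ih (by omega)
      omega
  have h₁ := key (k - 1) (by omega)
  have h₂ := (dyadicLevel_bounds_of_mem hy).2
  omega

lemma coveredDist_dyadic_bounds (hN : Function.Surjective N) (x y : X) :
    |(dyadicLevel (N x) : ℝ) - dyadicLevel (N y)| ≤
        2 * coveredDist (fun m => N ⁻¹' dyadicCoveringNN m) x y ∧
      coveredDist (fun m => N ⁻¹' dyadicCoveringNN m) x y ≤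
        |(dyadicLevel (N x) : ℝ) - dyadicLevel (N y)| + 1 := by
  unfold coveredDist
  split_ifs with hxy
  · simp [hxy]
  set S := {k : ℕ | ChainExists (fun m => N ⁻¹' dyadicCoveringNN m) k x y}
  obtain ⟨k, hkS, hk⟩ : ∃ k ∈ S, (k : ℝ) ≤ |(dyadicLevel (N x) : ℝ) - dyadicLevel (N y)| + 1 := by
    rcases le_total (dyadicLevel (N x)) (dyadicLevel (N y)) with h | h
    · refine ⟨_, chainExists_of_dyadicLevel_le hN h, ?_⟩
      push_cast [h]
      rw [abs_sub_comm]
      gcongr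
      exact le_abs_self _
    · refine ⟨_, (chainExists_of_dyadicLevel_le hN h).symm, ?_⟩
      push_cast [h]
      gcongr
      exact le_abs_self _
  have hmem : sInf S ∈ S := Nat.sInf_mem ⟨k, hkS⟩
  constructor
  · have h₁ : (dyadicLevel (N y) : ℝ) ≤ dyadicLevel (N x) + 2 * (sInf S : ℕ) :=
      mod_cast dyadicLevel_le_of_chainExists hmem
    have h₂ : (dyadicLevel (N x) : ℝ) ≤ dyadicLevel (N y) + 2 * (sInf S : ℕ) :=
      mod_cast dyadicLevel_le_of_chainExists (ChainExists.symm hmem)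
    rw [abs_le]
    constructor <;> linarith
  · exact le_trans (mod_cast Nat.sInf_le hkS) hk

end DyadicPullback

lemma dyadicCovering_eq_preimage (n : ℕ) :
    dyadicCovering n = fun m => (fun x => ‖x‖₊) ⁻¹' dyadicCoveringNN m := by
  funext m
  ext x
  unfold dyadicCovering dyadicCoveringNN
  split_ifs
  · simp [← NNReal.coe_le_coe]
  · simp [← NNReal.coe_le_coe]

lemma surjective_nnnorm_euclideanSpace {n : ℕ} (hn : 1 ≤ n) :
    Function.Surjective (fun x : EuclideanSpace ℝ (Fin n) => ‖x‖₊) := by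
  have : Nonempty (Fin n) := ⟨⟨0, hn⟩⟩
  intro r
  obtain ⟨x, hx⟩ := exists_norm_eq (EuclideanSpace ℝ (Fin n)) r.2
  exact ⟨x, NNReal.eq hx⟩

lemma surjective_nnnorm_pow_euclideanSpace {n : ℕ} (hn : 1 ≤ n) :
    Function.Surjective (fun x : EuclideanSpace ℝ (Fin n) => ‖x‖₊ ^ n) := by
  intro r
  obtain ⟨x, hx⟩ := surjective_nnnorm_euclideanSpace hn (r ^ ((n : ℝ)⁻¹))
  refine ⟨x, ?_⟩
  simp only at hx ⊢
  rw [hx, NNReal.rpow_inv_natCast_pow r (by omega)]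

lemma abs_dyadicLevel_pow_sub_bounds (r s : NNReal) {n : ℕ} (hn : 1 ≤ n) :
    n * |(dyadicLevel r : ℝ) - dyadicLevel s| - n ≤
        |(dyadicLevel (r ^ n) : ℝ) - dyadicLevel (s ^ n)| ∧
      |(dyadicLevel (r ^ n) : ℝ) - dyadicLevel (s ^ n)| ≤
        n * |(dyadicLevel r : ℝ) - dyadicLevel s| + n := by
  obtain ⟨hr₁, hr₂⟩ := dyadicLevel_pow_bounds r hn
  obtain ⟨hs₁, hs₂⟩ := dyadicLevel_pow_bounds s hn
  rify at hr₁ hr₂ hs₁ hs₂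
  have hclose : |((dyadicLevel (r ^ n) : ℝ) - dyadicLevel (s ^ n)) -
      n * ((dyadicLevel r : ℝ) - dyadicLevel s)| ≤ n := by
    rw [abs_le]
    constructor <;> linarith
  have hmul : |(n : ℝ) * ((dyadicLevel r : ℝ) - dyadicLevel s)| =
      n * |(dyadicLevel r : ℝ) - dyadicLevel s| := by
    rw [abs_mul, Nat.abs_cast]
  rw [← hmul]
  have h := abs_le.1 ((abs_abs_sub_abs_le _ _).trans hclose)
  constructor <;> linarith [h.1, h.2]

lemma isQIEmbedding_nnnorm_pow {n : ℕ} (hn : 1 ≤ n) :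
    IsQIEmbedding (coveredDist (dyadicCovering n)) (coveredDist dyadicCoveringNN)
      (fun x : EuclideanSpace ℝ (Fin n) => ‖x‖₊ ^ n) := by
  have hn' : (1 : ℝ) ≤ n := mod_cast hn
  refine ⟨2 * n, n + 1, by positivity, by positivity, fun x y => ?_⟩
  obtain ⟨hd₁, hd₂⟩ := coveredDist_dyadic_bounds (surjective_nnnorm_euclideanSpace hn) x y
  rw [← dyadicCovering_eq_preimage] at hd₁ hd₂
  obtain ⟨he₁, he₂⟩ :=
    coveredDist_dyadic_bounds Function.surjective_id (‖x‖₊ ^ n) (‖y‖₊ ^ n)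
  obtain ⟨hp₁, hp₂⟩ := abs_dyadicLevel_pow_sub_bounds ‖x‖₊ ‖y‖₊ hn
  simp only [preimage_id, id_eq] at he₁ he₂
  set d := coveredDist (dyadicCovering n) x y
  set e := coveredDist dyadicCoveringNN (‖x‖₊ ^ n) (‖y‖₊ ^ n)
  set a := |(dyadicLevel ‖x‖₊ : ℝ) - dyadicLevel ‖y‖₊|
  have ha : 0 ≤ a := abs_nonneg _
  have hd : 0 ≤ d := by linarith
  constructor
  · have h₁ : 1 / (2 * (n : ℝ)) * d ≤ n * d / 2 := by
      have : 1 / (2 * (n : ℝ)) ≤ n / 2 := by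
        rw [div_le_div_iff₀ (by positivity) (by norm_num)]
        nlinarith
      nlinarith
    have h₂ : (n : ℝ) * d ≤ n * (a + 1) := by gcongr
    linarith
  · have : (n : ℝ) * a ≤ n * (2 * d) := by gcongr
    linarith

/-- For every `n ≥ 1`, the map `φ(x) = ‖x‖₂ⁿ` is a surjective quasi-isometric
embedding (hence a quasi-isometry) from `(ℝⁿ, d_{B(ℝⁿ)})` to `([0,∞), d_{B⁺})`. -/
theorem statement17 (n : ℕ) (hn : 1 ≤ n) :
    Function.Surjective (fun x : EuclideanSpace ℝ (Fin n) => ‖x‖₊ ^ n) ∧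
    IsQIEmbedding (coveredDist (dyadicCovering n)) (coveredDist dyadicCoveringNN)
      (fun x : EuclideanSpace ℝ (Fin n) => ‖x‖₊ ^ n) ∧
    IsQuasiIsometry (coveredDist (dyadicCovering n)) (coveredDist dyadicCoveringNN)
      (fun x : EuclideanSpace ℝ (Fin n) => ‖x‖₊ ^ n) := by
  refine ⟨surjective_nnnorm_pow_euclideanSpace hn, isQIEmbedding_nnnorm_pow hn,
    isQIEmbedding_nnnorm_pow hn, 1, one_pos, fun z => ?_⟩
  obtain ⟨x, hx⟩ := surjective_nnnorm_pow_euclideanSpace hn z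
  refine ⟨x, ?_⟩
  rw [hx]
  simp [coveredDist]
end
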